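/- (Tight Typing, AST, and PAST) Let M be a closed term of Λ⊕^cbv. Then: (1) M is almost surely terminating (ProbTerm(M) = 1) if and only if sup { ‖𝔞‖ : there exists a tight derivation Π ⊳ ⊢ M : 𝔞 } = 1; and (2) M is positively almost surely terminating (ETime(M) < ∞) if and only if sup { w : there exist 𝔞 and a tight derivation Π ⊳ ⊢_w M : 𝔞 } < ∞. -/

import Mathlib

open scoped ENNReal

namespace CbV

/-! ### Terms of the probabilistic call-by-value λ-calculus `Λ⊕^cbv` -/

mutual
inductive Val : Type
  | var : ℕ → Val
  | lam : ℕ → Tm → Val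
inductive Tm : Type
  | val : Val → Tm
  | app : Val → Val → Tm
  | choice : Tm → Tm → Tm
  | letin : ℕ → Tm → Tm → Tm
end

-- Substitution of a value for a variable.
mutual
def substV : Val → ℕ → Val → Val
  | .var y, x, V => if y = x then V else .var y
  | .lam y M, x, V => if y = x then .lam y M else .lam y (substT M x V)
def substT : Tm → ℕ → Val → Tm
  | .val W, x, V => .val (substV W x V)
  | .app W U, x, V => .app (substV W x V) (substV U x V)
  | .choice M N, x, V => .choice (substT M x V) (substT N x V)
  | .letin y N M, x, V => .letin y (substT N x V) (if y = x then M else substT M x V)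
end

mutual
def fvV : Val → Finset ℕ
  | .var x => {x}
  | .lam x M => fvT M \ {x}
def fvT : Tm → Finset ℕ
  | .val V => fvV V
  | .app V W => fvV V ∪ fvV W
  | .choice M N => fvT M ∪ fvT N
  | .letin x N M => fvT N ∪ (fvT M \ {x})
end

def Tm.Closed (M : Tm) : Prop := fvT M = ∅
def Val.Closed (V : Val) : Prop := fvV V = ∅

def Tm.isVal : Tm → Bool
  | .val _ => true
  | _ => false

/-! ### Multidistributions and the operational semantics -/

/-- Multidistributions over terms, represented as finite multisets of scaled terms. -/
abbrev MDist := Multiset (ℚ × Tm)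

def scaleM (q : ℚ) (m : MDist) : MDist := m.map fun p => (q * p.1, p.2)

/-- One-step reduction from terms to multidistributions. -/
inductive Step : Tm → MDist → Prop
  | beta (x : ℕ) (M : Tm) (V : Val) :
      Step (.app (.lam x M) V) {(1, substT M x V)}
  | letval (x : ℕ) (V : Val) (M : Tm) :
      Step (.letin x (.val V) M) {(1, substT M x V)}
  | choice (M N : Tm) : Step (.choice M N) {(1/2, M), (1/2, N)}
  | letstep {N : Tm} {m : MDist} (x : ℕ) (M : Tm) :
      Step N m → Step (.letin x N M) (m.map fun p => (p.1, Tm.letin x p.2 M))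

/-- Lifting of one-step reduction to multidistributions. -/
inductive Lift : MDist → MDist → Prop
  | value (V : Val) : Lift {(1, Tm.val V)} {(1, Tm.val V)}
  | single {M : Tm} {m : MDist} : Step M m → Lift {(1, M)} m
  | multi (s : Multiset (ℚ × Tm × MDist)) :
      (∀ x ∈ s, Lift {(1, x.2.1)} x.2.2) →
      Lift (s.map fun x => (x.1, x.2.1)) ((s.map fun x => scaleM x.1 x.2.2).sum)

/-- Functional presentation of one-step reduction (values, and stuck open
terms, are kept unchanged); it agrees with `Step` on closed non-value terms. -/
def stepF : Tm → MDist
  | .val V => {(1, .val V)}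
  | .app (.lam x M) W => {(1, substT M x W)}
  | .app (.var y) W => {(1, .app (.var y) W)}
  | .choice M N => {(1/2, M), (1/2, N)}
  | .letin x (.val V) M => {(1, substT M x V)}
  | .letin x N M => (stepF N).map fun p => (p.1, Tm.letin x p.2 M)

def mstepF (m : MDist) : MDist := (m.map fun p => scaleM p.1 (stepF p.2)).sum

/-- The unique reduction sequence `[M] = 𝔪₀ ⇛ 𝔪₁ ⇛ …` of a closed term. -/
def traj (M : Tm) (k : ℕ) : MDist := mstepF^[k] {(1, M)}

/-- `‖𝔪‖𝒱`: the probability that `𝔪` is a value. -/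
def normV (m : MDist) : ℚ := ((m.filter fun p => p.2.isVal = true).map Prod.fst).sum

/-- `eval_k(M)`: the probability that `M` terminates within `k` steps. -/
def evalP (k : ℕ) (M : Tm) : ℚ := normV (traj M k)

/-- `ProbTerm(M) = sup_k eval_k(M)`. -/
noncomputable def ProbTerm (M : Tm) : ℝ := ⨆ k : ℕ, ((evalP k M : ℚ) : ℝ)

/-- `etime_n(M) = Σ_{k<n} (1 - eval_k(M))`. -/
def etime (n : ℕ) (M : Tm) : ℚ := ∑ k ∈ Finset.range n, (1 - evalP k M)

/-- `ETime(M) = Σ_{k≥0} (1 - eval_k(M)) ∈ [0,∞]`, the expected runtime. -/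
noncomputable def ETime (M : Tm) : ℝ≥0∞ :=
  ∑' k : ℕ, ENNReal.ofReal ((1 : ℝ) - ((evalP k M : ℚ) : ℝ))

/-! ### Non-idempotent monadic intersection types -/

/-- Arrow types `𝖠 ::= 𝒜 → 𝔞`, where `𝒜` is an intersection type
(a finite multiset of scaled arrow types, represented as a list) and `𝔞`
is a type distribution (a multidistribution of intersection types,
represented as a list). -/
inductive ATy : Type
  | arr : List (ℚ × ATy) → List (ℚ × List (ℚ × ATy)) → ATy

/-- Intersection types. -/
abbrev ITy := List (ℚ × ATy)
/-- Type distributions. -/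
abbrev DTy := List (ℚ × ITy)

/-- A type of any of the three kinds. -/
inductive Ty : Type
  | arrow : ATy → Ty
  | inter : ITy → Ty
  | dist : DTy → Ty

/-- Typing contexts. -/
abbrev Ctx := ℕ → ITy

def emptyCtx : Ctx := fun _ => []

def scaleL {α : Type} (q : ℚ) (l : List (ℚ × α)) : List (ℚ × α) :=
  l.map fun p => (q * p.1, p.2)

def ctxUnion (Γ Δ : Ctx) : Ctx := fun x => Γ x ++ Δ x

/-- A type distribution is tight if every intersection type in it is empty. -/
def Tight (a : DTy) : Prop := ∀ p ∈ a, p.2 = ([] : ITy)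

/-- `‖𝔞‖`: the sum of the probabilities occurring in a type distribution. -/
def normD (a : DTy) : ℚ := (a.map Prod.fst).sum

/-- Typing derivations `Π ⊳ Γ ⊢_w M : σ`. -/
inductive Deriv : Ctx → ℚ → Tm → Ty → Type
  | var (x : ℕ) (A : ITy) :
      Deriv (Function.update emptyCtx x A) 0 (.val (.var x)) (.inter A)
  | zero (M : Tm) : Deriv emptyCtx 0 M (.dist [])
  | lam {Γ : Ctx} {w : ℚ} {M : Tm} (x : ℕ) (b : DTy) :
      Deriv Γ w M (.dist b) →
      Deriv (Function.update Γ x []) (w + 1) (.val (.lam x M)) (.arrow (.arr (Γ x) b))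
  | app {Γ Δ : Ctx} {w v : ℚ} {V W : Val} {A : ITy} {b : DTy} :
      Deriv Γ w (.val V) (.inter [(1, .arr A b)]) →
      Deriv Δ v (.val W) (.inter A) →
      Deriv (ctxUnion Γ Δ) (w + v) (.app V W) (.dist b)
  | choice {Γ Δ : Ctx} {w v : ℚ} {M N : Tm} {a b : DTy} :
      Deriv Γ w M (.dist a) → Deriv Δ v N (.dist b) →
      Deriv (ctxUnion (fun y => scaleL (1/2) (Γ y)) (fun y => scaleL (1/2) (Δ y)))
        (w / 2 + v / 2 + 1) (.choice M N)
        (.dist (scaleL (1/2) a ++ scaleL (1/2) b))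
  | letin {Γ : Ctx} {v : ℚ} (x : ℕ) {N M : Tm}
      (K : List (ℚ × ITy × Ctx × ℚ × DTy)) :
      (∀ k ∈ K, k.2.2.1 x = []) →
      ((i : Fin K.length) →
        Deriv (Function.update (K.get i).2.2.1 x (K.get i).2.1)
          (K.get i).2.2.2.1 M (.dist (K.get i).2.2.2.2)) →
      Deriv Γ v N (.dist (K.map fun k => (k.1, k.2.1))) →
      Deriv (ctxUnion Γ (fun y => (K.map fun k => scaleL k.1 (k.2.2.1 y)).flatten))
        ((K.map fun k => k.1 * k.2.2.2.1).sum + v + 1)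
        (.letin x N M)
        (.dist (K.map fun k => scaleL k.1 k.2.2.2.2).flatten)
  | tval {Γ : Ctx} {w : ℚ} {V : Val} {A : ITy} :
      Deriv Γ w (.val V) (.inter A) → Deriv Γ w (.val V) (.dist [(1, A)])
  | bang {V : Val} (I : List (ℚ × Ctx × ℚ × ATy)) :
      (∀ k ∈ I, 0 < k.1 ∧ k.1 ≤ 1) →
      ((i : Fin I.length) →
        Deriv (I.get i).2.1 (I.get i).2.2.1 (.val V) (.arrow (I.get i).2.2.2)) →
      Deriv (fun y => (I.map fun k => scaleL k.1 (k.2.1 y)).flatten)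
        ((I.map fun k => k.1 * k.2.2.1).sum) (.val V)
        (.inter (I.map fun k => (k.1, k.2.2.2)))

/-- Size of a derivation: the number of rules, excluding `!` and `Val`. -/
def Deriv.size : ∀ {Γ : Ctx} {w : ℚ} {M : Tm} {τ : Ty}, Deriv Γ w M τ → ℕ
  | _, _, _, _, .var _ _ => 1
  | _, _, _, _, .zero _ => 1
  | _, _, _, _, .lam _ _ d => d.size + 1
  | _, _, _, _, .app d e => d.size + e.size + 1
  | _, _, _, _, .choice d e => d.size + e.size + 1
  | _, _, _, _, .letin _ _ _ f d => d.size + (List.ofFn fun i => (f i).size).sum + 1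
  | _, _, _, _, .tval d => d.size
  | _, _, _, _, .bang _ _ f => (List.ofFn fun i => (f i).size).sum


set_option linter.unusedSimpArgs false
set_option linter.unusedVariables false

/-! ### A term-recursive, parametrised presentation of typing -/

def sC (q : ℚ) (Γ : Ctx) : Ctx := fun y => scaleL q (Γ y)

inductive WSum {α : Type} (ok : ℚ → Prop) (P : α → Ctx → ℚ → ℕ → Prop) :
    List (ℚ × α) → Ctx → ℚ → ℕ → Prop
  | nil : WSum ok P [] emptyCtx 0 0
  | cons {q a Γ w n l Δ v m} : ok q → P a Γ w n → WSum ok P l Δ v m →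
      WSum ok P ((q, a) :: l) (ctxUnion (sC q Γ) Δ) (q * w + v) (n + m)

def lamP (x : ℕ) (T : DTy → Ctx → ℚ → ℕ → Prop) : ATy → Ctx → ℚ → ℕ → Prop
  | .arr A b, Γ, w, n => Γ x = [] ∧ ∃ w' n', T b (Function.update Γ x A) w' n' ∧
      w = w' + 1 ∧ n = n' + 1

def letP (x : ℕ) (T : DTy → Ctx → ℚ → ℕ → Prop) (ab : ITy × DTy) (Γ : Ctx) (w : ℚ) (n : ℕ) :
    Prop := Γ x = [] ∧ T ab.2 (Function.update Γ x ab.1) w n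

def ZT (d : DTy) (Γ : Ctx) (w : ℚ) (n : ℕ) : Prop := d = [] ∧ Γ = emptyCtx ∧ w = 0 ∧ n = 0

mutual
def IT (ok : ℚ → Prop) : Val → ITy → Ctx → ℚ → ℕ → Prop
  | .var x => fun A Γ w n => Γ = Function.update emptyCtx x A ∧ w = 0 ∧ n = 0
  | .lam x M => WSum ok (lamP x (TT ok M))
def TT (ok : ℚ → Prop) : Tm → DTy → Ctx → ℚ → ℕ → Prop
  | .val V => fun d Γ w n => ZT d Γ w n ∨ ∃ A, d = [(1, A)] ∧ IT ok V A Γ w n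
  | .app V W => fun d Γ w n => ZT d Γ w n ∨ ∃ A Γ1 Γ2 w1 w2 n1 n2,
      IT ok V [(1, .arr A d)] Γ1 w1 n1 ∧ IT ok W A Γ2 w2 n2 ∧
      Γ = ctxUnion Γ1 Γ2 ∧ w = w1 + w2 ∧ n = n1 + n2 + 1
  | .choice M N => fun d Γ w n => ZT d Γ w n ∨ ∃ a b Γ1 Γ2 w1 w2 n1 n2,
      TT ok M a Γ1 w1 n1 ∧ TT ok N b Γ2 w2 n2 ∧ d = scaleL (1/2) a ++ scaleL (1/2) b ∧
      Γ = ctxUnion (sC (1/2) Γ1) (sC (1/2) Γ2) ∧ w = w1 / 2 + w2 / 2 + 1 ∧ n = n1 + n2 + 1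
  | .letin x N M => fun d Γ w n => ZT d Γ w n ∨
      ∃ (l : List (ℚ × ITy × DTy)) (Γ1 Γ2 : Ctx) (w1 w2 : ℚ) (n1 n2 : ℕ),
      TT ok N (l.map fun k => (k.1, k.2.1)) Γ1 w1 n1 ∧
      WSum ok (letP x (TT ok M)) l Γ2 w2 n2 ∧
      d = (l.map fun k => scaleL k.1 k.2.2).flatten ∧
      Γ = ctxUnion Γ1 Γ2 ∧ w = w2 + w1 + 1 ∧ n = n1 + n2 + 1
end

/-! ### Contexts -/

@[simp] theorem emptyCtx_app (y : ℕ) : emptyCtx y = [] := rfl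
@[simp] theorem ctxUnion_app (Γ Δ : Ctx) (y : ℕ) : ctxUnion Γ Δ y = Γ y ++ Δ y := rfl
@[simp] theorem sC_app (q : ℚ) (Γ : Ctx) (y : ℕ) : sC q Γ y = scaleL q (Γ y) := rfl
@[simp] theorem scaleL_nil {α : Type} (q : ℚ) : scaleL q ([] : List (ℚ × α)) = [] := rfl
@[simp] theorem scaleL_eq_nil {α : Type} (q : ℚ) (l : List (ℚ × α)) :
    scaleL q l = [] ↔ l = [] := by simp [scaleL]
@[simp] theorem scaleL_cons {α : Type} (q : ℚ) (p : ℚ × α) (l : List (ℚ × α)) :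
    scaleL q (p :: l) = (q * p.1, p.2) :: scaleL q l := rfl
@[simp] theorem scaleL_append {α : Type} (q : ℚ) (l l' : List (ℚ × α)) :
    scaleL q (l ++ l') = scaleL q l ++ scaleL q l' := by simp [scaleL]
theorem scaleL_scaleL {α : Type} (q r : ℚ) (l : List (ℚ × α)) :
    scaleL q (scaleL r l) = scaleL (q * r) l := by simp [scaleL, mul_assoc]
@[simp] theorem scaleL_one {α : Type} (l : List (ℚ × α)) : scaleL 1 l = l := by simp [scaleL]
theorem sC_sC (q r : ℚ) (Γ : Ctx) : sC q (sC r Γ) = sC (q * r) Γ := by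
  funext y; simp [scaleL_scaleL]
@[simp] theorem sC_one (Γ : Ctx) : sC 1 Γ = Γ := by funext y; simp
@[simp] theorem sC_empty (q : ℚ) : sC q emptyCtx = emptyCtx := by funext y; simp
@[simp] theorem sC_eq_empty (q : ℚ) (Γ : Ctx) : sC q Γ = emptyCtx ↔ Γ = emptyCtx := by
  simp [funext_iff]
@[simp] theorem union_empty_left (Γ : Ctx) : ctxUnion emptyCtx Γ = Γ := by funext y; simp
@[simp] theorem union_empty_right (Γ : Ctx) : ctxUnion Γ emptyCtx = Γ := by funext y; simp
@[simp] theorem union_eq_empty (Γ Δ : Ctx) :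
    ctxUnion Γ Δ = emptyCtx ↔ Γ = emptyCtx ∧ Δ = emptyCtx := by
  simp [funext_iff, forall_and]
theorem union_assoc (Γ Δ Θ : Ctx) :
    ctxUnion (ctxUnion Γ Δ) Θ = ctxUnion Γ (ctxUnion Δ Θ) := by funext y; simp
theorem sC_union (q : ℚ) (Γ Δ : Ctx) :
    sC q (ctxUnion Γ Δ) = ctxUnion (sC q Γ) (sC q Δ) := by funext y; simp
@[simp] theorem upd_empty (x : ℕ) : Function.update emptyCtx x [] = emptyCtx := by
  funext y; by_cases h : y = x <;> simp [Function.update_apply]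
theorem upd_union (Γ Δ : Ctx) (x : ℕ) (A B : ITy) :
    Function.update (ctxUnion Γ Δ) x (A ++ B)
      = ctxUnion (Function.update Γ x A) (Function.update Δ x B) := by
  funext y; by_cases h : y = x <;> simp [Function.update_apply, h]
theorem upd_sC (q : ℚ) (Γ : Ctx) (x : ℕ) (A : ITy) :
    Function.update (sC q Γ) x (scaleL q A) = sC q (Function.update Γ x A) := by
  funext y; by_cases h : y = x <;> simp [Function.update_apply, h]
theorem upd_self (Γ : Ctx) (x : ℕ) (h : Γ x = []) : Function.update Γ x [] = Γ := by
  rw [← h]; simp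

/-! ### Weighted sums of derivations -/

section WS
variable {α : Type} {ok : ℚ → Prop} {P P' : α → Ctx → ℚ → ℕ → Prop}

theorem WSum.ctx_nil {l Γ w n y} (h : WSum ok P l Γ w n)
    (hP : ∀ a Γ w n, P a Γ w n → Γ y = []) : Γ y = [] := by
  induction h with
  | nil => rfl
  | cons _ h1 _ ih => simp [hP _ _ _ _ h1, ih]

theorem WSum.nil_inv {Γ w n} (h : WSum ok P [] Γ w n) : Γ = emptyCtx ∧ w = 0 ∧ n = 0 := by
  cases h; simp

theorem WSum.single_inv {q a Γ w n} (h : WSum ok P [(q, a)] Γ w n) :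
    ∃ Γ' w', P a Γ' w' n ∧ Γ = sC q Γ' ∧ w = q * w' := by
  cases h with
  | cons _ h1 h2 => cases h2; exact ⟨_, _, h1, by simp, by simp⟩

theorem WSum.single {q a Γ w n} (hq : ok q) (h : P a Γ w n) :
    WSum ok P [(q, a)] (sC q Γ) (q * w) n := by
  have := WSum.cons hq h WSum.nil
  simpa using this

theorem WSum.append {l1 l2 Γ1 Γ2 w1 w2 n1 n2} (h1 : WSum ok P l1 Γ1 w1 n1)
    (h2 : WSum ok P l2 Γ2 w2 n2) :
    WSum ok P (l1 ++ l2) (ctxUnion Γ1 Γ2) (w1 + w2) (n1 + n2) := by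
  induction h1 with
  | nil => simpa using h2
  | cons hq h _ ih =>
    have := WSum.cons hq h ih
    rw [List.cons_append, union_assoc, add_assoc, add_assoc]
    exact this

theorem WSum.append_inv {l1 l2 Γ w n} (h : WSum ok P (l1 ++ l2) Γ w n) :
    ∃ Γ1 Γ2 w1 w2 n1 n2, WSum ok P l1 Γ1 w1 n1 ∧ WSum ok P l2 Γ2 w2 n2 ∧
      Γ = ctxUnion Γ1 Γ2 ∧ w = w1 + w2 ∧ n = n1 + n2 := by
  induction l1 generalizing Γ w n with
  | nil => exact ⟨_, _, _, _, _, _, .nil, h, by simp, by simp, by simp⟩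
  | cons k l1 ih =>
    cases h with
    | cons hq h1 h2 =>
      obtain ⟨Γ1, Γ2, w1, w2, n1, n2, ha, hb, rfl, rfl, rfl⟩ := ih h2
      exact ⟨_, _, _, _, _, _, .cons hq h1 ha, hb, (union_assoc _ _ _).symm,
        (add_assoc _ _ _).symm, (add_assoc _ _ _).symm⟩

theorem WSum.scale {l Γ w n} {q : ℚ} (hm : ∀ r, ok r → ok (q * r)) (h : WSum ok P l Γ w n) :
    WSum ok P (scaleL q l) (sC q Γ) (q * w) n := by
  induction h with
  | nil => simpa using WSum.nil
  | cons hq h _ ih =>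
    have := WSum.cons (hm _ hq) h ih
    rw [scaleL_cons, sC_union, sC_sC, mul_add, ← mul_assoc]
    exact this

theorem WSum.scale_inv {l Γ w n} {q : ℚ} (hm : ∀ r, ok (q * r) → ok r)
    (h : WSum ok P (scaleL q l) Γ w n) :
    ∃ Γ' w', WSum ok P l Γ' w' n ∧ Γ = sC q Γ' ∧ w = q * w' := by
  induction l generalizing Γ w n with
  | nil => obtain ⟨rfl, rfl, rfl⟩ := WSum.nil_inv h; exact ⟨_, _, .nil, by simp, by simp⟩
  | cons k l ih =>
    rw [scaleL_cons] at h
    cases h with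
    | cons hq h1 h2 =>
      obtain ⟨Γ', w', h', rfl, rfl⟩ := ih h2
      exact ⟨_, _, .cons (hm _ hq) h1 h', by rw [sC_union, sC_sC], by ring⟩
end WS

/-! ### Relevance -/

mutual
theorem IT_fv {ok} : ∀ (V : Val) {A Γ w n}, IT ok V A Γ w n → ∀ y, y ∉ fvV V → Γ y = []
  | .var x, A, Γ, w, n, h, y, hy => by
    simp only [IT] at h
    simp only [fvV, Finset.mem_singleton] at hy
    simp [h.1, Function.update_apply, hy]
  | .lam x M, A, Γ, w, n, h, y, hy => by
    simp only [IT] at h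
    refine h.ctx_nil ?_
    rintro ⟨A, b⟩ Γ w n ⟨h1, w', n', h2, -, -⟩
    by_cases hxy : y = x
    · rw [hxy]; exact h1
    · have := TT_fv M h2 y (by simpa [fvV, hxy] using hy)
      simpa [Function.update_apply, hxy] using this
theorem TT_fv {ok} : ∀ (M : Tm) {d Γ w n}, TT ok M d Γ w n → ∀ y, y ∉ fvT M → Γ y = []
  | .val V, d, Γ, w, n, h, y, hy => by
    simp only [TT] at h
    rcases h with h | ⟨A, -, h⟩
    · simp [h.2.1]
    · exact IT_fv V h y (by simpa [fvT] using hy)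
  | .app V W, d, Γ, w, n, h, y, hy => by
    simp only [TT] at h
    simp only [fvT, Finset.mem_union, not_or] at hy
    rcases h with h | ⟨A, Γ1, Γ2, w1, w2, n1, n2, h1, h2, rfl, -, -⟩
    · simp [h.2.1]
    · simp [IT_fv V h1 y hy.1, IT_fv W h2 y hy.2]
  | .choice M N, d, Γ, w, n, h, y, hy => by
    simp only [TT] at h
    simp only [fvT, Finset.mem_union, not_or] at hy
    rcases h with h | ⟨a, b, Γ1, Γ2, w1, w2, n1, n2, h1, h2, -, rfl, -, -⟩
    · simp [h.2.1]
    · simp [TT_fv M h1 y hy.1, TT_fv N h2 y hy.2]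
  | .letin x N M, d, Γ, w, n, h, y, hy => by
    simp only [TT] at h
    simp only [fvT, Finset.mem_union, not_or] at hy
    rcases h with h | ⟨l, Γ1, Γ2, w1, w2, n1, n2, h1, h2, -, rfl, -, -⟩
    · simp [h.2.1]
    · have : Γ2 y = [] := by
        refine h2.ctx_nil ?_
        rintro ⟨A, b⟩ Γ w n ⟨h3, h4⟩
        by_cases hxy : y = x
        · rw [hxy]; exact h3
        · have := TT_fv M h4 y (by simpa [hxy] using hy.2)
          simpa [Function.update_apply, hxy] using this
      simp [TT_fv N h1 y hy.1, this]
end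

theorem IT_closed {ok V A Γ w n} (hV : Val.Closed V) (h : IT ok V A Γ w n) : Γ = emptyCtx := by
  funext y; exact IT_fv V h y (by rw [hV]; simp)
theorem TT_closed {ok M A Γ w n} (hV : Tm.Closed M) (h : TT ok M A Γ w n) : Γ = emptyCtx := by
  funext y; exact TT_fv M h y (by rw [hV]; simp)

theorem TT_zero {ok} (M : Tm) : TT ok M [] emptyCtx 0 0 := by
  cases M <;> simp [TT, ZT]

/-! ### Closed values -/

section CV
variable {ok : ℚ → Prop} {V : Val}

theorem CV_form (hV : V.Closed) : ∃ z L, V = .lam z L := by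
  cases V with
  | var x => simp [Val.Closed, fvV] at hV
  | lam z L => exact ⟨z, L, rfl⟩

theorem CV_nil (hV : V.Closed) : IT ok V [] emptyCtx 0 0 := by
  obtain ⟨z, L, rfl⟩ := CV_form hV; simpa only [IT] using WSum.nil

theorem CV_nil_inv (hV : V.Closed) {v m} (h : IT ok V [] emptyCtx v m) : v = 0 ∧ m = 0 := by
  obtain ⟨z, L, rfl⟩ := CV_form hV; simp only [IT] at h; exact h.nil_inv.2

theorem CV_append (hV : V.Closed) {A B v1 v2 m1 m2} (h1 : IT ok V A emptyCtx v1 m1)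
    (h2 : IT ok V B emptyCtx v2 m2) : IT ok V (A ++ B) emptyCtx (v1 + v2) (m1 + m2) := by
  obtain ⟨z, L, rfl⟩ := CV_form hV; simp only [IT] at *
  simpa using h1.append h2

theorem CV_append_inv (hV : V.Closed) {A B v m} (h : IT ok V (A ++ B) emptyCtx v m) : ∃ v1 v2 m1 m2,
    IT ok V A emptyCtx v1 m1 ∧ IT ok V B emptyCtx v2 m2 ∧ v = v1 + v2 ∧ m = m1 + m2 := by
  obtain ⟨z, L, rfl⟩ := CV_form hV; simp only [IT] at *
  obtain ⟨Γ1, Γ2, w1, w2, n1, n2, ha, hb, he, rfl, rfl⟩ := h.append_inv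
  obtain ⟨rfl, rfl⟩ := (union_eq_empty _ _).1 he.symm
  exact ⟨_, _, _, _, ha, hb, rfl, rfl⟩

theorem CV_scale (hV : V.Closed) {A v m} {q : ℚ} (hm : ∀ r, ok r → ok (q * r)) (h : IT ok V A emptyCtx v m) :
    IT ok V (scaleL q A) emptyCtx (q * v) m := by
  obtain ⟨z, L, rfl⟩ := CV_form hV; simp only [IT] at *
  simpa using h.scale hm

theorem CV_scale_inv (hV : V.Closed) {A v m} {q : ℚ} (hm : ∀ r, ok (q * r) → ok r)
    (h : IT ok V (scaleL q A) emptyCtx v m) : ∃ v',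
    IT ok V A emptyCtx v' m ∧ v = q * v' := by
  obtain ⟨z, L, rfl⟩ := CV_form hV; simp only [IT] at *
  obtain ⟨Γ', w', h', he, rfl⟩ := h.scale_inv hm
  obtain rfl := (sC_eq_empty _ _).1 he.symm
  exact ⟨_, h', rfl⟩
end CV

/-! ### Substitution -/

section Subst
variable {ok : ℚ → Prop} {V : Val} {x : ℕ}

def SubP (ok : ℚ → Prop) (V : Val) (x : ℕ) (P P' : Ctx → ℚ → ℕ → Prop) : Prop :=
  ∀ Γ w n v m, P Γ w n → IT ok V (Γ x) emptyCtx v m →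
    P' (Function.update Γ x []) (w + v) (n + m)

theorem WSum.subst {α : Type} {P P' : α → Ctx → ℚ → ℕ → Prop} (hV : V.Closed)
    (hok : ∀ q, ok q) (hP : ∀ a, SubP ok V x (P a) (P' a)) (l) :
    SubP ok V x (WSum ok P l) (WSum ok P' l) := by
  intro Γ w n v m h
  induction h generalizing v m with
  | nil =>
    intro h
    obtain ⟨rfl, rfl⟩ := CV_nil_inv hV h
    simpa using WSum.nil
  | @cons q a Γ w n l Δ v' m' hq h1 h2 ih =>
    intro h
    obtain ⟨v1, v2, m1, m2, ha, hb, rfl, rfl⟩ := CV_append_inv hV h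
    obtain ⟨v1', ha', rfl⟩ := CV_scale_inv (ok := ok) hV (fun _ _ => hok _) ha
    have := WSum.cons hq (hP _ _ _ _ _ _ h1 ha') (ih _ _ hb)
    rw [← upd_sC, ← upd_union] at this
    convert this using 1
    all_goals first | rfl | ring

theorem lamP_subst {y : ℕ} (hxy : y ≠ x) {T T' : DTy → Ctx → ℚ → ℕ → Prop}
    (hT : ∀ d, SubP ok V x (T d) (T' d)) (a) : SubP ok V x (lamP y T a) (lamP y T' a) := by
  obtain ⟨A, b⟩ := a
  rintro Γ w n v m ⟨h1, w', n', h2, rfl, rfl⟩ h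
  refine ⟨by simp [Function.update_apply, hxy, h1], w' + v, n' + m, ?_, by ring, by ring⟩
  rw [Function.update_comm hxy.symm]
  exact hT _ _ _ _ _ _ h2 (by simpa [Function.update_apply, hxy.symm] using h)

theorem letP_subst {y : ℕ} (hxy : y ≠ x) {T T' : DTy → Ctx → ℚ → ℕ → Prop}
    (hT : ∀ d, SubP ok V x (T d) (T' d)) (a) : SubP ok V x (letP y T a) (letP y T' a) := by
  obtain ⟨A, b⟩ := a
  rintro Γ w n v m ⟨h1, h2⟩ h
  refine ⟨by simp [Function.update_apply, hxy, h1], ?_⟩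
  rw [Function.update_comm hxy.symm]
  exact hT _ _ _ _ _ _ h2 (by simpa [Function.update_apply, hxy.symm] using h)

theorem SubP_id (hV : V.Closed) {P : Ctx → ℚ → ℕ → Prop}
    (hP : ∀ Γ w n, P Γ w n → Γ x = []) : SubP ok V x P P := by
  intro Γ w n v m h1 h2
  have := hP _ _ _ h1
  rw [this] at h2
  obtain ⟨rfl, rfl⟩ := CV_nil_inv hV h2
  rw [upd_self _ _ this]; simpa using h1

theorem ZT_subst (hV : V.Closed) {d Γ w n v m} (h : ZT d Γ w n)
    (h2 : IT ok V (Γ x) emptyCtx v m) : ZT d (Function.update Γ x []) (w + v) (n + m) := by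
  obtain ⟨rfl, rfl, rfl, rfl⟩ := h
  obtain ⟨rfl, rfl⟩ := CV_nil_inv hV h2
  simp [ZT]

mutual
theorem IT_subst (hV : V.Closed) (hok : ∀ q, ok q) : ∀ (W : Val) (A : ITy),
    SubP ok V x (IT ok W A) (IT ok (substV W x V) A)
  | .var y, A => by
    by_cases hxy : y = x
    · subst hxy
      intro Γ w n v m h1 h2
      simp only [IT] at h1
      obtain ⟨rfl, rfl, rfl⟩ := h1
      simpa [substV] using h2
    · simp only [substV, hxy, if_false]
      refine SubP_id hV ?_
      intro Γ w n h
      exact IT_fv _ h _ (by simpa [fvV] using Ne.symm hxy)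
  | .lam y M, A => by
    by_cases hxy : y = x
    · simp only [substV, hxy, if_true]
      refine SubP_id hV ?_
      intro Γ w n h
      exact IT_fv _ h _ (by simp [fvV])
    · simp only [substV, hxy, if_false, IT]
      exact WSum.subst hV hok (lamP_subst hxy (TT_subst hV hok M)) A
theorem TT_subst (hV : V.Closed) (hok : ∀ q, ok q) : ∀ (M : Tm) (d : DTy),
    SubP ok V x (TT ok M d) (TT ok (substT M x V) d)
  | .val W, d => by
    intro Γ w n v m h1 h2
    simp only [TT, substT] at *
    rcases h1 with h1 | ⟨A, rfl, h1⟩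
    · exact .inl (ZT_subst hV h1 h2)
    · exact .inr ⟨A, rfl, IT_subst hV hok W A _ _ _ _ _ h1 h2⟩
  | .app W U, d => by
    intro Γ w n v m h1 h2
    simp only [TT, substT] at *
    rcases h1 with h1 | ⟨A, Γ1, Γ2, w1, w2, n1, n2, ha, hb, rfl, rfl, rfl⟩
    · exact .inl (ZT_subst hV h1 h2)
    · obtain ⟨v1, v2, m1, m2, hv1, hv2, rfl, rfl⟩ := CV_append_inv hV h2
      exact .inr ⟨A, _, _, _, _, _, _, IT_subst hV hok W _ _ _ _ _ _ ha hv1,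
        IT_subst hV hok U _ _ _ _ _ _ hb hv2, by rw [← upd_union]; rfl, by ring, by ring⟩
  | .choice M N, d => by
    intro Γ w n v m h1 h2
    simp only [TT, substT] at *
    rcases h1 with h1 | ⟨a, b, Γ1, Γ2, w1, w2, n1, n2, ha, hb, hd, rfl, rfl, rfl⟩
    · exact .inl (ZT_subst hV h1 h2)
    · obtain ⟨v1, v2, m1, m2, hv1, hv2, rfl, rfl⟩ := CV_append_inv hV h2
      obtain ⟨v1, hw1, rfl⟩ := CV_scale_inv (ok := ok) hV (fun _ _ => hok _) hv1
      obtain ⟨v2, hw2, rfl⟩ := CV_scale_inv (ok := ok) hV (fun _ _ => hok _) hv2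
      exact .inr ⟨a, b, _, _, _, _, _, _, TT_subst hV hok M _ _ _ _ _ _ ha hw1,
        TT_subst hV hok N _ _ _ _ _ _ hb hw2, hd,
        by rw [← upd_sC, ← upd_sC, ← upd_union]; rfl, by ring, by ring⟩
  | .letin y N M, d => by
    intro Γ w n v m h1 h2
    simp only [TT, substT] at *
    rcases h1 with h1 | ⟨l, Γ1, Γ2, w1, w2, n1, n2, ha, hb, hd, rfl, rfl, rfl⟩
    · exact .inl (ZT_subst hV h1 h2)
    · obtain ⟨v1, v2, m1, m2, hv1, hv2, rfl, rfl⟩ := CV_append_inv hV h2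
      refine .inr ⟨l, Function.update Γ1 x [], Function.update Γ2 x [], w1 + v1, w2 + v2,
        n1 + m1, n2 + m2, TT_subst hV hok N _ _ _ _ _ _ ha hv1, ?_, hd,
        by rw [← upd_union]; rfl, by ring, by ring⟩
      have key : ∀ a, SubP ok V x (letP y (TT ok M) a)
          (letP y (TT ok (if y = x then M else substT M x V)) a) := by
        by_cases hxy : y = x
        · subst hxy
          intro a
          simp only [if_true]
          exact SubP_id hV (fun Γ w n h => h.1)
        · simp only [hxy, if_false]
          exact letP_subst hxy (TT_subst hV hok M)
      exact WSum.subst hV hok key l _ _ _ _ _ hb hv2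
end

/-! ### Anti-substitution -/

def AntiP (ok : ℚ → Prop) (V : Val) (x : ℕ) (P P' : Ctx → ℚ → ℕ → Prop) : Prop :=
  ∀ Γ w n, P' Γ w n → Γ x = [] ∧ ∃ A v m w' n', IT ok V A emptyCtx v m ∧
    P (Function.update Γ x A) w' n' ∧ w = w' + v

theorem WSum.anti {α : Type} {P P' : α → Ctx → ℚ → ℕ → Prop} (hV : V.Closed)
    (hok : ∀ q r, ok q → ok r → ok (q * r)) (hP : ∀ a, AntiP ok V x (P a) (P' a)) (l) :
    AntiP ok V x (WSum ok P l) (WSum ok P' l) := by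
  intro Γ w n h
  induction h with
  | nil => exact ⟨rfl, [], 0, 0, 0, 0, CV_nil hV, by simpa using WSum.nil, by simp⟩
  | @cons q a Γ w n l Δ v' m' hq h1 h2 ih =>
    obtain ⟨e2, A2, v2, m2, w2, n2, hA2, h2', rfl⟩ := ih
    obtain ⟨e1, A1, v1, m1, w1, n1, hA1, h1', rfl⟩ := hP _ _ _ _ h1
    refine ⟨by simp [e1, e2], scaleL q A1 ++ A2, _, _, q * w1 + w2, n1 + n2,
      CV_append hV (CV_scale hV (fun r => hok q r hq) hA1) hA2, ?_, ?_⟩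
    · rw [upd_union, upd_sC]
      exact WSum.cons hq h1' h2'
    · ring

theorem lamP_anti {y : ℕ} (hxy : y ≠ x) {T T' : DTy → Ctx → ℚ → ℕ → Prop}
    (hT : ∀ d, AntiP ok V x (T d) (T' d)) (a) : AntiP ok V x (lamP y T a) (lamP y T' a) := by
  obtain ⟨A, b⟩ := a
  rintro Γ w n ⟨h1, w', n', h2, rfl, rfl⟩
  obtain ⟨e, B, v, m, w1, n1, hB, h3, rfl⟩ := hT _ _ _ _ h2
  refine ⟨by simpa [Function.update_apply, hxy.symm] using e, B, v, m, w1 + 1, n1 + 1, hB,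
    ⟨by simp [Function.update_apply, hxy, h1], w1, n1, ?_, rfl, rfl⟩, by ring⟩
  rw [Function.update_comm hxy.symm]
  exact h3

theorem letP_anti {y : ℕ} (hxy : y ≠ x) {T T' : DTy → Ctx → ℚ → ℕ → Prop}
    (hT : ∀ d, AntiP ok V x (T d) (T' d)) (a) : AntiP ok V x (letP y T a) (letP y T' a) := by
  obtain ⟨A, b⟩ := a
  rintro Γ w n ⟨h1, h2⟩
  obtain ⟨e, B, v, m, w1, n1, hB, h3, rfl⟩ := hT _ _ _ _ h2
  refine ⟨by simpa [Function.update_apply, hxy.symm] using e, B, v, m, w1, n1, hB,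
    ⟨by simp [Function.update_apply, hxy, h1], ?_⟩, by ring⟩
  rw [Function.update_comm hxy.symm]
  exact h3

theorem AntiP_id (hV : V.Closed) {P : Ctx → ℚ → ℕ → Prop}
    (hP : ∀ Γ w n, P Γ w n → Γ x = []) : AntiP ok V x P P := by
  intro Γ w n h1
  have := hP _ _ _ h1
  exact ⟨this, [], 0, 0, w, n, CV_nil hV, by rwa [upd_self _ _ this], by simp⟩

theorem ZT_anti (hV : V.Closed) {d} : AntiP ok V x (ZT d) (ZT d) :=
  AntiP_id hV (fun Γ w n h => by simp [h.2.1])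

theorem AntiP_inl {P P' Q Q' : Ctx → ℚ → ℕ → Prop} (h1 : AntiP ok V x P P')
    (h2 : AntiP ok V x Q Q') :
    AntiP ok V x (fun Γ w n => P Γ w n ∨ Q Γ w n) (fun Γ w n => P' Γ w n ∨ Q' Γ w n) := by
  rintro Γ w n (h | h)
  · obtain ⟨e, A, v, m, w', n', a, b, c⟩ := h1 _ _ _ h
    exact ⟨e, A, v, m, w', n', a, .inl b, c⟩
  · obtain ⟨e, A, v, m, w', n', a, b, c⟩ := h2 _ _ _ h
    exact ⟨e, A, v, m, w', n', a, .inr b, c⟩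

mutual
theorem IT_anti (hV : V.Closed) (hok : ∀ q r, ok q → ok r → ok (q * r)) (hhalf : ok (1/2)) :
    ∀ (W : Val) (A : ITy), AntiP ok V x (IT ok W A) (IT ok (substV W x V) A)
  | .var y, A => by
    by_cases hxy : y = x
    · subst hxy
      intro Γ w n h
      simp only [substV, if_true] at h
      obtain rfl := IT_closed hV h
      exact ⟨rfl, A, w, n, 0, 0, h, by simp [IT], by simp⟩
    · simp only [substV, hxy, if_false]
      refine AntiP_id hV ?_
      intro Γ w n h
      exact IT_fv _ h _ (by simpa [fvV] using Ne.symm hxy)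
  | .lam y M, A => by
    by_cases hxy : y = x
    · simp only [substV, hxy, if_true]
      refine AntiP_id hV ?_
      intro Γ w n h
      exact IT_fv _ h _ (by simp [fvV])
    · simp only [substV, hxy, if_false, IT]
      exact WSum.anti hV hok (lamP_anti hxy (TT_anti hV hok hhalf M)) A
theorem TT_anti (hV : V.Closed) (hok : ∀ q r, ok q → ok r → ok (q * r)) (hhalf : ok (1/2)) :
    ∀ (M : Tm) (d : DTy), AntiP ok V x (TT ok M d) (TT ok (substT M x V) d)
  | .val W, d => by
    simp only [TT, substT]
    refine AntiP_inl (ZT_anti hV) ?_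
    rintro Γ w n ⟨A, rfl, h⟩
    obtain ⟨e, B, v, m, w', n', a, b, c⟩ := IT_anti hV hok hhalf W A _ _ _ h
    exact ⟨e, B, v, m, w', n', a, ⟨A, rfl, b⟩, c⟩
  | .app W U, d => by
    simp only [TT, substT]
    refine AntiP_inl (ZT_anti hV) ?_
    rintro Γ w n ⟨A, Γ1, Γ2, w1, w2, n1, n2, ha, hb, rfl, rfl, rfl⟩
    obtain ⟨e1, B1, v1, m1, w1', n1', a1, b1, rfl⟩ := IT_anti hV hok hhalf W _ _ _ _ ha
    obtain ⟨e2, B2, v2, m2, w2', n2', a2, b2, rfl⟩ := IT_anti hV hok hhalf U _ _ _ _ hb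
    exact ⟨by simp [e1, e2], B1 ++ B2, _, _, _, _, CV_append hV a1 a2,
      ⟨A, _, _, _, _, _, _, b1, b2, upd_union _ _ _ _ _, rfl, rfl⟩, by ring⟩
  | .choice M N, d => by
    simp only [TT, substT]
    refine AntiP_inl (ZT_anti hV) ?_
    rintro Γ w n ⟨a, b, Γ1, Γ2, w1, w2, n1, n2, ha, hb, hd, rfl, rfl, rfl⟩
    obtain ⟨e1, B1, v1, m1, w1', n1', a1, b1, rfl⟩ := TT_anti hV hok hhalf M _ _ _ _ ha
    obtain ⟨e2, B2, v2, m2, w2', n2', a2, b2, rfl⟩ := TT_anti hV hok hhalf N _ _ _ _ hb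
    exact ⟨by simp [e1, e2], scaleL (1/2) B1 ++ scaleL (1/2) B2, _, _, _, _,
      CV_append hV (CV_scale hV (fun r => hok _ r hhalf) a1)
        (CV_scale hV (fun r => hok _ r hhalf) a2),
      ⟨a, b, _, _, _, _, _, _, b1, b2, hd, by rw [upd_union, upd_sC, upd_sC], rfl, rfl⟩, by ring⟩
  | .letin y N M, d => by
    simp only [TT, substT]
    refine AntiP_inl (ZT_anti hV) ?_
    rintro Γ w n ⟨l, Γ1, Γ2, w1, w2, n1, n2, ha, hb, hd, rfl, rfl, rfl⟩
    have key : ∀ a, AntiP ok V x (letP y (TT ok M) a)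
        (letP y (TT ok (if y = x then M else substT M x V)) a) := by
      by_cases hxy : y = x
      · subst hxy
        intro a
        simp only [if_true]
        exact AntiP_id hV (fun Γ w n h => h.1)
      · simp only [hxy, if_false]
        exact letP_anti hxy (TT_anti hV hok hhalf M)
    obtain ⟨e1, B1, v1, m1, w1', n1', a1, b1, rfl⟩ := TT_anti hV hok hhalf N _ _ _ _ ha
    obtain ⟨e2, B2, v2, m2, w2', n2', a2, b2, rfl⟩ := WSum.anti hV hok key l _ _ _ hb
    exact ⟨by simp [e1, e2], B1 ++ B2, _, _, _, _, CV_append hV a1 a2,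
      ⟨l, _, _, _, _, _, _, b1, b2, hd, upd_union _ _ _ _ _, rfl, rfl⟩, by ring⟩
end
end Subst

/-! ### Reduction: deterministic and probabilistic steps -/

inductive StepD : Tm → Tm → Prop
  | beta (x M V) : StepD (.app (.lam x M) V) (substT M x V)
  | letval (x V M) : StepD (.letin x (.val V) M) (substT M x V)
  | ctx {N N'} (x M) : StepD N N' → StepD (.letin x N M) (.letin x N' M)

inductive StepC : Tm → Tm → Tm → Prop
  | choice (M N) : StepC (.choice M N) M N
  | ctx {N N1 N2} (x M) : StepC N N1 N2 →
      StepC (.letin x N M) (.letin x N1 M) (.letin x N2 M)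

theorem progress : ∀ (M : Tm), M.Closed →
    (∃ V, M = .val V) ∨ (∃ M', StepD M M') ∨ (∃ M1 M2, StepC M M1 M2)
  | .val V, h => .inl ⟨V, rfl⟩
  | .app (.lam x M) W, h => .inr (.inl ⟨_, .beta _ _ _⟩)
  | .app (.var y) W, h => by
    exfalso
    have : y ∈ fvT (.app (.var y) W) := by simp [fvT, fvV]
    rw [show fvT (.app (.var y) W) = ∅ from h] at this
    simp at this
  | .choice M N, h => .inr (.inr ⟨_, _, .choice _ _⟩)
  | .letin x N M, h => by
    have hN : N.Closed := by
      have h' : fvT N ∪ (fvT M \ {x}) = ∅ := by simpa [Tm.Closed, fvT] using h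
      exact (Finset.union_eq_empty.1 h').1
    rcases progress N hN with ⟨V, rfl⟩ | ⟨N', h'⟩ | ⟨N1, N2, h'⟩
    · exact .inr (.inl ⟨_, .letval _ _ _⟩)
    · exact .inr (.inl ⟨_, .ctx _ _ h'⟩)
    · exact .inr (.inr ⟨_, _, .ctx _ _ h'⟩)

theorem StepD.notVal {M M'} (h : StepD M M') : ∀ V, M ≠ .val V := by
  intro V; cases h <;> simp
theorem StepC.notVal {M M1 M2} (h : StepC M M1 M2) : ∀ V, M ≠ .val V := by
  intro V; cases h <;> simp

theorem stepF_let {N : Tm} (h : ∀ V, N ≠ .val V) (x M) :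
    stepF (.letin x N M) = (stepF N).map fun p => (p.1, Tm.letin x p.2 M) := by
  cases N with
  | val V => exact absurd rfl (h V)
  | app V W => simp only [stepF]
  | choice M N => simp only [stepF]
  | letin y N M => simp only [stepF]

theorem StepD.stepF_eq {M M'} (h : StepD M M') : stepF M = {(1, M')} := by
  induction h with
  | beta => simp [stepF]
  | letval => simp [stepF]
  | ctx x M h ih => rw [stepF_let h.notVal, ih]; simp

theorem StepC.stepF_eq {M M1 M2} (h : StepC M M1 M2) :
    stepF M = {(1/2, M1), (1/2, M2)} := by
  induction h with
  | choice => simp [stepF]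
  | ctx x M h ih => rw [stepF_let h.notVal, ih]; simp

mutual
theorem fv_substV {V : Val} {x : ℕ} (hV : V.Closed) :
    ∀ W : Val, fvV (substV W x V) ⊆ fvV W \ {x}
  | .var y => by
    by_cases h : y = x
    · simp [substV, h, show fvV V = ∅ from hV]
    · intro z hz
      simp [substV, h, fvV] at hz ⊢
      subst hz; exact ⟨rfl, h⟩
  | .lam y M => by
    by_cases h : y = x
    · intro z hz
      simp [substV, h, fvV] at hz ⊢
      exact hz
    · intro z hz
      simp [substV, h, fvV] at hz ⊢
      have := fv_substT hV M hz.1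
      simp at this
      exact ⟨⟨this.1, hz.2⟩, this.2⟩
theorem fv_substT {V : Val} {x : ℕ} (hV : V.Closed) :
    ∀ M : Tm, fvT (substT M x V) ⊆ fvT M \ {x}
  | .val W => by simpa [substT, fvT] using fv_substV hV W
  | .app W U => by
    intro z hz
    simp only [substT, fvT, Finset.mem_union] at hz
    have h1 := @fv_substV V x hV W z
    have h2 := @fv_substV V x hV U z
    simp [fvT] at *
    tauto
  | .choice M N => by
    intro z hz
    simp only [substT, fvT, Finset.mem_union] at hz
    have h1 := @fv_substT V x hV M z
    have h2 := @fv_substT V x hV N z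
    simp [fvT] at *
    tauto
  | .letin y N M => by
    intro z hz
    simp only [substT, fvT, Finset.mem_union] at hz
    have h1 := @fv_substT V x hV M z
    have h2 := @fv_substT V x hV N z
    by_cases h : y = x
    · simp [fvT, h] at *
      tauto
    · simp [fvT, h] at *
      tauto
end

theorem let_closed {x N M} : (Tm.letin x N M).Closed ↔ N.Closed ∧ fvT M \ {x} = ∅ := by
  simp only [Tm.Closed, fvT, Finset.union_eq_empty]
theorem app_closed {V W} : (Tm.app V W).Closed ↔ V.Closed ∧ W.Closed := by
  simp only [Tm.Closed, Val.Closed, fvT, Finset.union_eq_empty]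
theorem choice_closed {V W} : (Tm.choice V W).Closed ↔ V.Closed ∧ W.Closed := by
  simp only [Tm.Closed, fvT, Finset.union_eq_empty]
theorem val_closed {V} : (Tm.val V).Closed ↔ V.Closed := by
  simp only [Tm.Closed, Val.Closed, fvT]

theorem subst_closed {M x V} (hV : Val.Closed V) (hM : fvT M \ {x} = ∅) :
    (substT M x V).Closed := by
  have := @fv_substT V x hV M
  rw [hM] at this
  exact Finset.subset_empty.1 this

theorem StepD.closed {M M'} (h : StepD M M') (hM : M.Closed) : M'.Closed := by
  induction h with
  | beta x M V =>
    rw [app_closed] at hM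
    exact subst_closed hM.2 (by simpa [Val.Closed, fvV] using hM.1)
  | letval x V M =>
    rw [let_closed, val_closed] at hM
    exact subst_closed hM.1 hM.2
  | ctx x M h ih =>
    rw [let_closed] at *
    exact ⟨ih hM.1, hM.2⟩

theorem StepC.closed {M M1 M2} (h : StepC M M1 M2) (hM : M.Closed) :
    M1.Closed ∧ M2.Closed := by
  induction h with
  | choice => exact choice_closed.1 hM
  | ctx x M h ih =>
    rw [let_closed] at *
    rw [let_closed]
    exact ⟨⟨(ih hM.1).1, hM.2⟩, ⟨(ih hM.1).2, hM.2⟩⟩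

/-! ### Subject reduction -/

theorem TT_size0 {ok M d Γ w} (hv : ∀ V, M ≠ .val V) (h : TT ok M d Γ w 0) : d = [] ∧ w = 0 := by
  cases M with
  | val V => exact absurd rfl (hv V)
  | app V W =>
    simp only [TT] at h
    rcases h with h | ⟨A, Γ1, Γ2, w1, w2, n1, n2, h1, h2, h3, h4, h5⟩
    · exact ⟨h.1, h.2.2.1⟩
    · omega
  | choice M N =>
    simp only [TT] at h
    rcases h with h | ⟨a, b, Γ1, Γ2, w1, w2, n1, n2, h1, h2, h3, h4, h5, h6⟩
    · exact ⟨h.1, h.2.2.1⟩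
    · omega
  | letin x N M =>
    simp only [TT] at h
    rcases h with h | ⟨l, Γ1, Γ2, w1, w2, n1, n2, h1, h2, h3, h4, h5, h6⟩
    · exact ⟨h.1, h.2.2.1⟩
    · omega

theorem SR_D {ok : ℚ → Prop} (hok : ∀ q, ok q) {M M'} (h : StepD M M') (hM : M.Closed) {a w n}
    (ht : TT ok M a emptyCtx w n) :
    ∃ w' n', TT ok M' a emptyCtx w' n' ∧ w ≤ w' + 1 ∧ n' ≤ n - 1 := by
  induction h generalizing a w n with
  | beta x M V =>
    rw [app_closed] at hM
    simp only [TT] at ht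
    rcases ht with ⟨rfl, -, rfl, rfl⟩ | ⟨A, Γ1, Γ2, w1, w2, n1, n2, h1, h2, -, rfl, rfl⟩
    · exact ⟨0, 0, TT_zero _, by norm_num, le_rfl⟩
    · obtain rfl := IT_closed hM.1 h1
      obtain rfl := IT_closed hM.2 h2
      simp only [IT] at h1
      obtain ⟨Γ', w', ⟨e, w0, n0, h3, rfl, rfl⟩, hΓ, rfl⟩ := h1.single_inv
      obtain rfl := (sC_eq_empty _ _).1 hΓ.symm
      have := TT_subst (x := x) hM.2 hok _ _ _ _ _ _ _ h3 (by simpa using h2)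
      simp only [Function.update_idem, upd_empty] at this
      exact ⟨_, _, this, by linarith, by omega⟩
  | letval x V M =>
    rw [let_closed, val_closed] at hM
    simp only [TT] at ht
    rcases ht with ⟨rfl, -, rfl, rfl⟩ | ⟨l, Γ1, Γ2, w1, w2, n1, n2, h1, h2, hd, hΓ, rfl, rfl⟩
    · exact ⟨0, 0, TT_zero _, by norm_num, le_rfl⟩
    · obtain ⟨rfl, rfl⟩ := (union_eq_empty _ _).1 hΓ.symm
      rcases h1 with ⟨hl, -, rfl, rfl⟩ | ⟨A, hl, h1⟩
      · have : l = [] := by simpa using hl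
        subst this
        obtain ⟨-, rfl, rfl⟩ := h2.nil_inv
        subst hd
        exact ⟨0, 0, TT_zero _, by norm_num, by omega⟩
      · obtain ⟨⟨p, B, b⟩, rfl, hB⟩ := List.map_eq_singleton_iff.1 hl
        simp only [Prod.mk.injEq] at hB
        obtain ⟨rfl, rfl⟩ := hB
        obtain ⟨Γ', w', ⟨e, h3⟩, hΓ', rfl⟩ := h2.single_inv
        obtain rfl := (sC_eq_empty _ _).1 hΓ'.symm
        have := TT_subst (x := x) hM.1 hok _ _ _ _ _ _ _ h3 (by simpa using h1)
        simp only [Function.update_idem, upd_empty] at this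
        exact ⟨_, _, by simpa [hd] using this, by linarith, by omega⟩
  | ctx x M hs ih =>
    rw [let_closed] at hM
    simp only [TT] at ht
    rcases ht with ⟨rfl, -, rfl, rfl⟩ | ⟨l, Γ1, Γ2, w1, w2, n1, n2, h1, h2, hd, hΓ, rfl, rfl⟩
    · exact ⟨0, 0, TT_zero _, by norm_num, le_rfl⟩
    · obtain ⟨rfl, rfl⟩ := (union_eq_empty _ _).1 hΓ.symm
      rcases Nat.eq_zero_or_pos n1 with rfl | hn
      · obtain ⟨hl, rfl⟩ := TT_size0 hs.notVal h1
        have : l = [] := by simpa using hl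
        subst this
        obtain ⟨-, rfl, rfl⟩ := h2.nil_inv
        subst hd
        exact ⟨0, 0, TT_zero _, by norm_num, by omega⟩
      · obtain ⟨w', n', h3, hw, hn'⟩ := ih hM.1 h1
        refine ⟨w2 + w' + 1, n' + n2 + 1, ?_, by linarith, by omega⟩
        simp only [TT]
        exact .inr ⟨l, _, _, _, _, _, _, h3, h2, hd, by simp, rfl, rfl⟩

theorem flat_scale (q : ℚ) (l : List (ℚ × ITy × DTy)) :
    ((scaleL q l).map fun k => scaleL k.1 k.2.2).flatten
      = scaleL q (l.map fun k => scaleL k.1 k.2.2).flatten := by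
  induction l with
  | nil => rfl
  | cons k l ih => simp [ih, scaleL_scaleL]

theorem map_scale (q : ℚ) (l : List (ℚ × ITy × DTy)) :
    ((scaleL q l).map fun k => (k.1, k.2.1)) = scaleL q (l.map fun k => (k.1, k.2.1)) := by
  simp [scaleL]

theorem map_split {l : List (ℚ × ITy × DTy)} {d1 d2 : DTy}
    (h : (l.map fun k => (k.1, k.2.1)) = scaleL (1/2) d1 ++ scaleL (1/2) d2) :
    ∃ l1 l2, l = scaleL (1/2) l1 ++ scaleL (1/2) l2 ∧ (l1.map fun k => (k.1, k.2.1)) = d1 ∧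
      (l2.map fun k => (k.1, k.2.1)) = d2 := by
  obtain ⟨l1, l2, rfl, h1, h2⟩ := List.map_eq_append_iff.1 h
  refine ⟨scaleL 2 l1, scaleL 2 l2, ?_, ?_, ?_⟩
  · rw [scaleL_scaleL, scaleL_scaleL]; norm_num
  · rw [map_scale, h1, scaleL_scaleL]; norm_num
  · rw [map_scale, h2, scaleL_scaleL]; norm_num

theorem SR_C {ok : ℚ → Prop} (hok : ∀ q, ok q) {M M1 M2} (h : StepC M M1 M2) (hM : M.Closed)
    {a w n} (ht : TT ok M a emptyCtx w n) :
    ∃ a1 a2 w1 w2 n1 n2, TT ok M1 a1 emptyCtx w1 n1 ∧ TT ok M2 a2 emptyCtx w2 n2 ∧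
      a = scaleL (1/2) a1 ++ scaleL (1/2) a2 ∧
      w ≤ w1 / 2 + w2 / 2 + 1 ∧ n1 ≤ n - 1 ∧ n2 ≤ n - 1 := by
  induction h generalizing a w n with
  | choice M N =>
    simp only [TT] at ht
    rcases ht with ⟨rfl, -, rfl, rfl⟩ | ⟨a, b, Γ1, Γ2, w1, w2, n1, n2, h1, h2, rfl, hΓ, rfl, rfl⟩
    · exact ⟨[], [], 0, 0, 0, 0, TT_zero _, TT_zero _, rfl, by norm_num, le_rfl, le_rfl⟩
    · rw [choice_closed] at hM
      obtain rfl := TT_closed hM.1 h1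
      obtain rfl := TT_closed hM.2 h2
      exact ⟨a, b, w1, w2, n1, n2, h1, h2, rfl, le_rfl, by omega, by omega⟩
  | ctx x M hs ih =>
    rw [let_closed] at hM
    simp only [TT] at ht
    rcases ht with ⟨rfl, -, rfl, rfl⟩ | ⟨l, Γ1, Γ2, w1, w2, n1, n2, h1, h2, hd, hΓ, rfl, rfl⟩
    · exact ⟨[], [], 0, 0, 0, 0, TT_zero _, TT_zero _, rfl, by norm_num, le_rfl, le_rfl⟩
    · obtain ⟨rfl, rfl⟩ := (union_eq_empty _ _).1 hΓ.symm
      rcases Nat.eq_zero_or_pos n1 with rfl | hn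
      · obtain ⟨hl, rfl⟩ := TT_size0 hs.notVal h1
        have : l = [] := by simpa using hl
        subst this
        obtain ⟨-, rfl, rfl⟩ := h2.nil_inv
        subst hd
        exact ⟨[], [], 0, 0, 0, 0, TT_zero _, TT_zero _, rfl, by norm_num, by omega, by omega⟩
      · obtain ⟨d1, d2, v1, v2, m1, m2, t1, t2, hl, hw, hm1, hm2⟩ := ih hM.1 h1
        obtain ⟨l1, l2, rfl, rfl, rfl⟩ := map_split hl
        obtain ⟨Δ1, Δ2, u1, u2, k1, k2, s1, s2, hΔ, rfl, rfl⟩ := h2.append_inv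
        obtain ⟨rfl, rfl⟩ := (union_eq_empty _ _).1 hΔ.symm
        obtain ⟨Θ1, u1, r1, e1, rfl⟩ := s1.scale_inv (fun _ _ => hok _)
        obtain ⟨Θ2, u2, r2, e2, rfl⟩ := s2.scale_inv (fun _ _ => hok _)
        obtain rfl := (sC_eq_empty _ _).1 e1.symm
        obtain rfl := (sC_eq_empty _ _).1 e2.symm
        refine ⟨(l1.map fun k => scaleL k.1 k.2.2).flatten,
          (l2.map fun k => scaleL k.1 k.2.2).flatten, u1 + v1 + 1, u2 + v2 + 1, m1 + k1 + 1, m2 + k2 + 1,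
          ?_, ?_, ?_, by linarith, by omega, by omega⟩
        · simp only [TT]
          exact .inr ⟨l1, _, _, _, _, _, _, t1, r1, rfl, by simp, rfl, rfl⟩
        · simp only [TT]
          exact .inr ⟨l2, _, _, _, _, _, _, t2, r2, rfl, by simp, rfl, rfl⟩
        · rw [hd, List.map_append, List.flatten_append, flat_scale, flat_scale]

/-! ### Subject expansion -/

theorem let_form {ok : ℚ → Prop} {x N M a w n}
    (h : TT ok (.letin x N M) a emptyCtx w n) : ∃ (l : List (ℚ × ITy × DTy))
      (w1 w2 : ℚ) (n1 n2 : ℕ), TT ok N (l.map fun k => (k.1, k.2.1)) emptyCtx w1 n1 ∧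
      WSum ok (letP x (TT ok M)) l emptyCtx w2 n2 ∧
      a = (l.map fun k => scaleL k.1 k.2.2).flatten ∧ w ≤ w2 + w1 + 1 := by
  simp only [TT] at h
  rcases h with ⟨rfl, -, rfl, rfl⟩ | ⟨l, Γ1, Γ2, w1, w2, n1, n2, h1, h2, hd, hΓ, rfl, rfl⟩
  · exact ⟨[], 0, 0, 0, 0, TT_zero _, .nil, rfl, by norm_num⟩
  · obtain ⟨rfl, rfl⟩ := (union_eq_empty _ _).1 hΓ.symm
    exact ⟨l, w1, w2, n1, n2, h1, h2, hd, le_rfl⟩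

theorem let_intro {ok : ℚ → Prop} {x N M w1 w2 n1 n2} {l : List (ℚ × ITy × DTy)}
    (h1 : TT ok N (l.map fun k => (k.1, k.2.1)) emptyCtx w1 n1)
    (h2 : WSum ok (letP x (TT ok M)) l emptyCtx w2 n2) :
    TT ok (.letin x N M) (l.map fun k => scaleL k.1 k.2.2).flatten emptyCtx (w2 + w1 + 1)
      (n1 + n2 + 1) := by
  simp only [TT]
  exact .inr ⟨l, _, _, _, _, _, _, h1, h2, rfl, by simp, rfl, rfl⟩

section Exp
variable {ok : ℚ → Prop}

theorem SE_D (hok : ∀ q r, ok q → ok r → ok (q * r)) (hhalf : ok (1/2)) (hone : ok 1)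
    {M M'} (h : StepD M M') (hM : M.Closed) {a w n}
    (ht : TT ok M' a emptyCtx w n) :
    ∃ w' n', TT ok M a emptyCtx w' n' ∧ w + 1 ≤ w' := by
  induction h generalizing a w n with
  | beta x M V =>
    rw [app_closed] at hM
    obtain ⟨-, A, v, m, w', n', hA, h, rfl⟩ := TT_anti hM.2 hok hhalf M a _ _ _ ht
    refine ⟨1 * (w' + 1) + v, n' + 1 + m + 1, ?_, by linarith⟩
    simp only [TT]
    refine .inr ⟨A, emptyCtx, emptyCtx, _, _, _, _, ?_, hA, by simp, rfl, rfl⟩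
    have : lamP x (TT ok M) (.arr A a) emptyCtx (w' + 1) (n' + 1) :=
      ⟨rfl, w', n', h, rfl, rfl⟩
    simpa only [IT, sC_empty] using WSum.single hone this
  | letval x V M =>
    rw [let_closed, val_closed] at hM
    obtain ⟨-, A, v, m, w', n', hA, h, rfl⟩ := TT_anti hM.1 hok hhalf M a _ _ _ ht
    have h2 : letP x (TT ok M) (A, a) emptyCtx w' n' := ⟨rfl, h⟩
    have h3 := WSum.single hone h2
    rw [sC_empty] at h3
    have h4 : TT ok (.val V) ([((1 : ℚ), A, a)].map fun k => (k.1, k.2.1)) emptyCtx v m := by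
      simp only [TT]
      exact .inr ⟨A, rfl, hA⟩
    have h5 := let_intro h4 h3
    simp only [List.map_cons, List.map_nil, List.flatten_cons, List.flatten_nil, scaleL_one,
      List.append_nil] at h5
    exact ⟨_, _, h5, by linarith⟩
  | ctx x M hs ih =>
    rw [let_closed] at hM
    obtain ⟨l, w1, w2, n1, n2, h1, h2, rfl, hw⟩ := let_form ht
    obtain ⟨w', n', h3, hw'⟩ := ih hM.1 h1
    exact ⟨_, _, let_intro h3 h2, by linarith⟩

theorem SE_C (hok : ∀ q r, ok q → ok r → ok (q * r)) (hhalf : ok (1/2))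
    {M M1 M2} (h : StepC M M1 M2) {a1 w1 n1 a2 w2 n2}
    (ht1 : TT ok M1 a1 emptyCtx w1 n1) (ht2 : TT ok M2 a2 emptyCtx w2 n2) :
    ∃ w' n', TT ok M (scaleL (1/2) a1 ++ scaleL (1/2) a2) emptyCtx w' n' ∧
      w1 / 2 + w2 / 2 + 1 ≤ w' := by
  induction h generalizing a1 w1 n1 a2 w2 n2 with
  | choice M N =>
    refine ⟨w1 / 2 + w2 / 2 + 1, n1 + n2 + 1, ?_, le_rfl⟩
    simp only [TT]
    exact .inr ⟨a1, a2, _, _, _, _, _, _, ht1, ht2, rfl, by simp, rfl, rfl⟩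
  | ctx x M hs ih =>
    obtain ⟨l1, u1, v1, p1, q1, s1, t1, rfl, hw1⟩ := let_form ht1
    obtain ⟨l2, u2, v2, p2, q2, s2, t2, rfl, hw2⟩ := let_form ht2
    obtain ⟨w', n', h3, hw'⟩ := ih s1 s2
    rw [← map_scale, ← map_scale, ← List.map_append] at h3
    have h4 := (t1.scale (fun r => hok _ r hhalf)).append (t2.scale (fun r => hok _ r hhalf))
    rw [sC_empty, union_empty_left] at h4
    have h5 := let_intro h3 h4
    rw [List.map_append, List.flatten_append, flat_scale, flat_scale] at h5
    exact ⟨_, _, h5, by linarith⟩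
end Exp

/-! ### Evaluation -/

theorem scaleM_add (q : ℚ) (m m' : MDist) : scaleM q (m + m') = scaleM q m + scaleM q m' := by
  simp [scaleM]
theorem scaleM_scaleM (q r : ℚ) (m : MDist) : scaleM q (scaleM r m) = scaleM (q * r) m := by
  simp [scaleM, mul_assoc]
theorem scaleM_one (m : MDist) : scaleM 1 m = m := by simp [scaleM]
theorem scaleM_zero' (q : ℚ) : scaleM q 0 = 0 := by simp [scaleM]

theorem mstepF_add (m m' : MDist) : mstepF (m + m') = mstepF m + mstepF m' := by
  simp [mstepF]

theorem mstepF_scale (q : ℚ) (m : MDist) : mstepF (scaleM q m) = scaleM q (mstepF m) := by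
  induction m using Multiset.induction_on with
  | empty => simp [mstepF, scaleM]
  | cons p m ih =>
    rw [← Multiset.singleton_add, scaleM_add, mstepF_add, mstepF_add, scaleM_add, ih]
    congr 1
    simp only [mstepF, Multiset.map_singleton, Multiset.sum_singleton, scaleM_scaleM]
    simp [scaleM, mul_assoc]

theorem mstepF_it_add (k : ℕ) (m m' : MDist) :
    mstepF^[k] (m + m') = mstepF^[k] m + mstepF^[k] m' := by
  induction k generalizing m m' with
  | zero => rfl
  | succ k ih => simp [Function.iterate_succ_apply, mstepF_add, ih]

theorem mstepF_it_scale (k : ℕ) (q : ℚ) (m : MDist) :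
    mstepF^[k] (scaleM q m) = scaleM q (mstepF^[k] m) := by
  induction k generalizing m with
  | zero => rfl
  | succ k ih => simp [Function.iterate_succ_apply, mstepF_scale, ih]

theorem normV_add (m m' : MDist) : normV (m + m') = normV m + normV m' := by
  simp [normV]

theorem normV_scale (q : ℚ) (m : MDist) : normV (scaleM q m) = q * normV m := by
  induction m using Multiset.induction_on with
  | empty => simp [normV, scaleM]
  | cons p m ih =>
    rw [← Multiset.singleton_add, scaleM_add, normV_add, normV_add, ih, mul_add]
    congr 1
    by_cases h : p.2.isVal = true <;> simp [normV, scaleM, Multiset.filter_singleton, h]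

theorem mstepF_single (M : Tm) : mstepF {(1, M)} = stepF M := by
  simp [mstepF, scaleM_one]

theorem evalP_succ (k : ℕ) (M : Tm) : evalP (k+1) M = normV (mstepF^[k] (stepF M)) := by
  rw [evalP, traj, Function.iterate_succ_apply, mstepF_single]

theorem evalP_D {M M'} (h : StepD M M') (k) : evalP (k+1) M = evalP k M' := by
  rw [evalP_succ, h.stepF_eq]; rfl

theorem evalP_C {M M1 M2} (h : StepC M M1 M2) (k) :
    evalP (k+1) M = evalP k M1 / 2 + evalP k M2 / 2 := by
  rw [evalP_succ, h.stepF_eq]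
  have : ({(1/2, M1), (1/2, M2)} : MDist) =
      scaleM (1/2) {(1, M1)} + scaleM (1/2) {(1, M2)} := by simp [scaleM]
  rw [this, mstepF_it_add, normV_add, mstepF_it_scale, mstepF_it_scale, normV_scale, normV_scale]
  simp only [evalP, traj]; ring

theorem evalP_val (k V) : evalP k (.val V) = 1 := by
  induction k with
  | zero =>
    simp only [evalP, traj, Function.iterate_zero, id, normV, Multiset.filter_singleton]
    simp [Tm.isVal]
  | succ k ih =>
    rw [evalP_succ, show stepF (.val V) = {(1, .val V)} by simp [stepF]]; exact ih

theorem evalP_zero {M : Tm} (h : ∀ V, M ≠ .val V) : evalP 0 M = 0 := by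
  cases M with
  | val V => exact absurd rfl (h V)
  | _ =>
    simp only [evalP, traj, Function.iterate_zero, id, normV, Multiset.filter_singleton]
    simp [Tm.isVal]

theorem evalP_bounds (k : ℕ) : ∀ M : Tm, M.Closed → 0 ≤ evalP k M ∧ evalP k M ≤ 1 := by
  induction k with
  | zero =>
    intro M hM
    rcases progress M hM with ⟨V, rfl⟩ | ⟨M', h⟩ | ⟨M1, M2, h⟩
    · simp [evalP_val]
    · simp [evalP_zero h.notVal]
    · simp [evalP_zero h.notVal]
  | succ k ih =>
    intro M hM
    rcases progress M hM with ⟨V, rfl⟩ | ⟨M', h⟩ | ⟨M1, M2, h⟩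
    · simp [evalP_val]
    · rw [evalP_D h]; exact ih _ (h.closed hM)
    · rw [evalP_C h]
      have h1 := ih _ (h.closed hM).1
      have h2 := ih _ (h.closed hM).2
      constructor <;> linarith

theorem etime_val (k V) : etime k (.val V) = 0 := by simp [etime, evalP_val]

theorem etime_D {M M'} (h : StepD M M') (k) : etime (k+1) M = etime k M' + 1 := by
  simp only [etime, Finset.sum_range_succ', evalP_zero h.notVal, evalP_D h, sub_zero]

theorem etime_C {M M1 M2} (h : StepC M M1 M2) (k) :
    etime (k+1) M = etime k M1 / 2 + etime k M2 / 2 + 1 := by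
  simp only [etime, Finset.sum_range_succ', evalP_zero h.notVal, evalP_C h, sub_zero]
  rw [Finset.sum_div, Finset.sum_div, ← Finset.sum_add_distrib]
  congr 1
  refine Finset.sum_congr rfl fun i _ => ?_
  ring

@[simp] theorem normD_append (a b : DTy) : normD (a ++ b) = normD a + normD b := by
  simp [normD]
@[simp] theorem normD_scale (q : ℚ) (a : DTy) : normD (scaleL q a) = q * normD a := by
  induction a with
  | nil => simp [normD]
  | cons p a ih => simp [normD, scaleL, mul_add] at *; exact ih

theorem tight_scale {q : ℚ} {a : DTy} : Tight (scaleL q a) ↔ Tight a := by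
  constructor
  · intro h p hp
    exact h (q * p.1, p.2) (List.mem_map.2 ⟨p, hp, rfl⟩)
  · intro h p hp
    obtain ⟨p', hp', rfl⟩ := List.mem_map.1 hp
    exact h p' hp'
theorem tight_append {a b : DTy} : Tight (a ++ b) ↔ Tight a ∧ Tight b := by
  simp only [Tight, List.mem_append, or_imp, forall_and]

theorem sound {ok : ℚ → Prop} (hok : ∀ q, ok q) (s : ℕ) : ∀ (M : Tm), M.Closed →
    ∀ a w n, n ≤ s → Tight a → TT ok M a emptyCtx w n →
    normD a ≤ evalP s M ∧ w ≤ etime s M := by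
  have hval : ∀ s V a w n, Val.Closed V → Tight a → TT ok (.val V) a emptyCtx w n →
      normD a ≤ evalP s (.val V) ∧ w ≤ etime s (.val V) := by
    intro s V a w n hV ha ht
    rw [evalP_val, etime_val]
    simp only [TT] at ht
    rcases ht with ⟨rfl, -, rfl, rfl⟩ | ⟨A, rfl, h⟩
    · simp [normD]
    · have : A = [] := ha (1, A) (by simp)
      subst this
      obtain ⟨rfl, rfl⟩ := CV_nil_inv hV h
      simp [normD]
  induction s with
  | zero =>
    intro M hM a w n hn ha ht
    obtain rfl : n = 0 := by omega
    rcases progress M hM with ⟨V, rfl⟩ | ⟨M', h⟩ | ⟨M1, M2, h⟩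
    · exact hval _ _ _ _ _ (val_closed.1 hM) ha ht
    · obtain ⟨rfl, rfl⟩ := TT_size0 h.notVal ht
      simp [evalP_zero h.notVal, etime, normD]
    · obtain ⟨rfl, rfl⟩ := TT_size0 h.notVal ht
      simp [evalP_zero h.notVal, etime, normD]
  | succ s ih =>
    intro M hM a w n hn ha ht
    rcases progress M hM with ⟨V, rfl⟩ | ⟨M', h⟩ | ⟨M1, M2, h⟩
    · exact hval _ _ _ _ _ (val_closed.1 hM) ha ht
    · obtain ⟨w', n', h1, hw, hn'⟩ := SR_D hok h hM ht
      have := ih _ (h.closed hM) a w' n' (by omega) ha h1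
      rw [evalP_D h, etime_D h]
      exact ⟨this.1, by linarith⟩
    · obtain ⟨a1, a2, w1, w2, n1, n2, h1, h2, rfl, hw, hn1, hn2⟩ := SR_C hok h hM ht
      rw [tight_append, tight_scale, tight_scale] at ha
      have g1 := ih _ (h.closed hM).1 a1 w1 n1 (by omega) ha.1 h1
      have g2 := ih _ (h.closed hM).2 a2 w2 n2 (by omega) ha.2 h2
      rw [evalP_C h, etime_C h, normD_append, normD_scale, normD_scale]
      constructor
      · linarith [g1.1, g2.1]
      · linarith [g1.2, g2.2]

theorem complete {ok : ℚ → Prop} (hok : ∀ q r, ok q → ok r → ok (q * r)) (hhalf : ok (1/2))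
    (hone : ok 1) (k : ℕ) : ∀ (M : Tm), M.Closed →
    ∃ a w n, Tight a ∧ TT ok M a emptyCtx w n ∧ normD a = evalP k M ∧ etime k M ≤ w := by
  have hval : ∀ k V, Val.Closed V → ∃ a w n, Tight a ∧ TT ok (.val V) a emptyCtx w n ∧
      normD a = evalP k (.val V) ∧ etime k (.val V) ≤ w := by
    intro k V hV
    refine ⟨[(1, [])], 0, 0, by simp [Tight], ?_, by simp [normD, evalP_val], by simp [etime_val]⟩
    simp only [TT]
    exact .inr ⟨[], rfl, CV_nil hV⟩
  induction k with
  | zero =>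
    intro M hM
    rcases progress M hM with ⟨V, rfl⟩ | ⟨M', h⟩ | ⟨M1, M2, h⟩
    · exact hval _ _ (val_closed.1 hM)
    · exact ⟨[], 0, 0, by simp [Tight], TT_zero _, by simp [normD, evalP_zero h.notVal],
        by simp [etime]⟩
    · exact ⟨[], 0, 0, by simp [Tight], TT_zero _, by simp [normD, evalP_zero h.notVal],
        by simp [etime]⟩
  | succ k ih =>
    intro M hM
    rcases progress M hM with ⟨V, rfl⟩ | ⟨M', h⟩ | ⟨M1, M2, h⟩
    · exact hval _ _ (val_closed.1 hM)
    · obtain ⟨a, w, n, ha, ht, hn, hw⟩ := ih _ (h.closed hM)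
      obtain ⟨w', n', h1, h2⟩ := SE_D hok hhalf hone h hM ht
      exact ⟨a, w', n', ha, h1, by rw [evalP_D h, hn], by rw [etime_D h]; linarith⟩
    · obtain ⟨a1, w1, n1, ha1, ht1, hn1, hw1⟩ := ih _ (h.closed hM).1
      obtain ⟨a2, w2, n2, ha2, ht2, hn2, hw2⟩ := ih _ (h.closed hM).2
      obtain ⟨w', n', h1, h2⟩ := SE_C hok hhalf h ht1 ht2
      refine ⟨_, w', n', ?_, h1, ?_, by rw [etime_C h]; linarith⟩
      · rw [tight_append, tight_scale, tight_scale]; exact ⟨ha1, ha2⟩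
      · rw [evalP_C h, normD_append, normD_scale, normD_scale, hn1, hn2]; ring


/-! ### Typing derivations and the term-recursive presentation -/

section Build
variable {α : Type} {ok : ℚ → Prop} {P : α → Ctx → ℚ → ℕ → Prop}

theorem WSum.build (I : List (ℚ × Ctx × ℚ × α))
    (h : ∀ k ∈ I, ok k.1 ∧ ∃ n, P k.2.2.2 k.2.1 k.2.2.1 n) :
    ∃ n, WSum ok P (I.map fun k => (k.1, k.2.2.2))
      (fun y => (I.map fun k => scaleL k.1 (k.2.1 y)).flatten)
      ((I.map fun k => k.1 * k.2.2.1).sum) n := by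
  induction I with
  | nil => exact ⟨0, .nil⟩
  | cons k I ih =>
    obtain ⟨n, hn⟩ := ih fun k hk => h k (List.mem_cons_of_mem _ hk)
    obtain ⟨hk, m, hm⟩ := h k List.mem_cons_self
    exact ⟨_, WSum.cons hk hm hn⟩

theorem WSum.unbuild {l Γ w n} (h : WSum ok P l Γ w n) :
    ∃ I : List (ℚ × Ctx × ℚ × α), (∀ k ∈ I, ok k.1 ∧ ∃ n, P k.2.2.2 k.2.1 k.2.2.1 n) ∧
      l = (I.map fun k => (k.1, k.2.2.2)) ∧
      Γ = (fun y => (I.map fun k => scaleL k.1 (k.2.1 y)).flatten) ∧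
      w = (I.map fun k => k.1 * k.2.2.1).sum := by
  induction h with
  | nil => exact ⟨[], by simp, rfl, rfl, rfl⟩
  | @cons q a Γ w n l Δ v m hq hP _ ih =>
    obtain ⟨I, hI, rfl, rfl, rfl⟩ := ih
    refine ⟨(q, Γ, w, a) :: I, ?_, rfl, rfl, rfl⟩
    intro k hk
    rcases List.mem_cons.1 hk with rfl | hk
    · exact ⟨hq, n, hP⟩
    · exact hI k hk
end Build

def Good (Γ : Ctx) (w : ℚ) (M : Tm) : Ty → Prop
  | .dist a => ∃ n, TT (fun _ => True) M a Γ w n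
  | .inter A => ∃ V n, M = .val V ∧ IT (fun _ => True) V A Γ w n
  | .arrow A => ∃ x L n, M = .val (.lam x L) ∧ lamP x (TT (fun _ => True) L) A Γ w n

theorem Deriv.good {Γ w M τ} (h : Deriv Γ w M τ) : Good Γ w M τ := by
  induction h with
  | var x A => exact ⟨.var x, 0, rfl, by simp [IT]⟩
  | zero M => exact ⟨0, TT_zero M⟩
  | @lam Γ w M x b _ ih =>
    obtain ⟨n, hn⟩ := ih
    refine ⟨x, M, n + 1, rfl, by simp, w, n, ?_, rfl, rfl⟩
    simpa using hn
  | app _ _ ih1 ih2 =>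
    obtain ⟨V', n, hV, h1⟩ := ih1
    obtain ⟨W', m, hW, h2⟩ := ih2
    cases hV; cases hW
    refine ⟨n + m + 1, ?_⟩
    simp only [TT]
    exact .inr ⟨_, _, _, _, _, _, _, h1, h2, rfl, rfl, rfl⟩
  | choice _ _ ih1 ih2 =>
    obtain ⟨n, h1⟩ := ih1
    obtain ⟨m, h2⟩ := ih2
    refine ⟨n + m + 1, ?_⟩
    simp only [TT]
    exact .inr ⟨_, _, _, _, _, _, _, _, h1, h2, rfl, rfl, rfl, rfl⟩
  | @letin Γ v x N M K hx _ _ ih1 ih2 =>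
    obtain ⟨m, h2⟩ := ih2
    obtain ⟨n, h1⟩ := WSum.build (ok := fun _ => True) (P := letP x (TT (fun _ => True) M))
      (K.map fun k => (k.1, k.2.2.1, k.2.2.2.1, (k.2.1, k.2.2.2.2))) (by
        intro k hk
        obtain ⟨k, hk', rfl⟩ := List.mem_map.1 hk
        refine ⟨trivial, ?_⟩
        obtain ⟨i, rfl⟩ := List.mem_iff_get.1 hk'
        obtain ⟨n, hn⟩ := ih1 i
        exact ⟨n, hx _ hk', hn⟩)
    simp only [List.map_map] at h1
    refine ⟨m + n + 1, ?_⟩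
    simp only [TT]
    refine .inr ⟨_, _, _, _, _, _, _, ?_, h1, ?_, rfl, rfl, rfl⟩
    · simp only [List.map_map]; exact h2
    · simp only [List.map_map]; rfl
  | tval _ ih =>
    obtain ⟨V', n, hV, h1⟩ := ih
    cases hV
    refine ⟨n, ?_⟩
    simp only [TT]
    exact .inr ⟨_, rfl, h1⟩
  | @bang V I hI _ ih =>
    cases V with
    | var x =>
      have : I = [] := by
        cases I with
        | nil => rfl
        | cons k I =>
          obtain ⟨y, L, n, hV, -⟩ := ih ⟨0, by simp⟩
          simp at hV
      subst this
      refine ⟨.var x, 0, rfl, ?_⟩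
      simp only [IT, List.map_nil, upd_empty, List.sum_nil, and_self, and_true]
      rfl
    | lam x M =>
      obtain ⟨n, h1⟩ := WSum.build (ok := fun _ => True) (P := lamP x (TT (fun _ => True) M)) I (by
        intro k hk
        refine ⟨trivial, ?_⟩
        obtain ⟨i, rfl⟩ := List.mem_iff_get.1 hk
        obtain ⟨y, L, n, hV, h⟩ := ih i
        cases hV
        exact ⟨n, h⟩)
      exact ⟨_, n, rfl, by simpa only [IT] using h1⟩

def ok01 (q : ℚ) : Prop := 0 < q ∧ q ≤ 1

mutual
theorem IT_deriv : ∀ (V : Val) {A Γ w n}, IT ok01 V A Γ w n →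
    Nonempty (Deriv Γ w (.val V) (.inter A))
  | .var x, A, Γ, w, n, h => by
    simp only [IT] at h
    obtain ⟨rfl, rfl, rfl⟩ := h
    exact ⟨.var x A⟩
  | .lam x M, A, Γ, w, n, h => by
    simp only [IT] at h
    obtain ⟨I, hI, rfl, rfl, rfl⟩ := h.unbuild
    have key : ∀ i : Fin I.length, Nonempty (Deriv (I.get i).2.1 (I.get i).2.2.1
        (.val (.lam x M)) (.arrow (I.get i).2.2.2)) := by
      intro i
      obtain ⟨-, n, hn⟩ := hI _ (List.get_mem I i)
      generalize I.get i = k at hn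
      obtain ⟨q, Γ, w, ⟨A, b⟩⟩ := k
      obtain ⟨hx, w', n', h1, h2, h3⟩ := hn
      obtain ⟨d⟩ := TT_deriv M h1
      have d2 := Deriv.lam x b d
      simp only [Function.update_idem, Function.update_self, upd_self Γ x hx] at d2
      dsimp only at h2 ⊢
      rw [h2]
      exact ⟨d2⟩
    exact ⟨.bang I (fun k hk => (hI k hk).1) fun i => Classical.choice (key i)⟩
theorem TT_deriv : ∀ (M : Tm) {d Γ w n}, TT ok01 M d Γ w n → Nonempty (Deriv Γ w M (.dist d))
  | .val V, d, Γ, w, n, h => by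
    simp only [TT] at h
    rcases h with ⟨rfl, rfl, rfl, rfl⟩ | ⟨A, rfl, h⟩
    · exact ⟨.zero _⟩
    · obtain ⟨e⟩ := IT_deriv V h
      exact ⟨.tval e⟩
  | .app V W, d, Γ, w, n, h => by
    simp only [TT] at h
    rcases h with ⟨rfl, rfl, rfl, rfl⟩ | ⟨A, Γ1, Γ2, w1, w2, n1, n2, h1, h2, rfl, rfl, rfl⟩
    · exact ⟨.zero _⟩
    · obtain ⟨e⟩ := IT_deriv V h1
      obtain ⟨f⟩ := IT_deriv W h2
      exact ⟨.app e f⟩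
  | .choice M N, d, Γ, w, n, h => by
    simp only [TT] at h
    rcases h with ⟨rfl, rfl, rfl, rfl⟩ | ⟨a, b, Γ1, Γ2, w1, w2, n1, n2, h1, h2, rfl, rfl, rfl, rfl⟩
    · exact ⟨.zero _⟩
    · obtain ⟨e⟩ := TT_deriv M h1
      obtain ⟨f⟩ := TT_deriv N h2
      exact ⟨.choice e f⟩
  | .letin x N M, d, Γ, w, n, h => by
    simp only [TT] at h
    rcases h with ⟨rfl, rfl, rfl, rfl⟩ | ⟨l, Γ1, Γ2, w1, w2, n1, n2, h1, h2, rfl, rfl, rfl, rfl⟩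
    · exact ⟨.zero _⟩
    · obtain ⟨e⟩ := TT_deriv N h1
      obtain ⟨I, hI, rfl, rfl, rfl⟩ := h2.unbuild
      have key : ∀ k ∈ I.map fun k : ℚ × Ctx × ℚ × ITy × DTy => (k.1, k.2.2.2.1, k.2.1, k.2.2.1, k.2.2.2.2),
          k.2.2.1 x = [] ∧ Nonempty (Deriv (Function.update k.2.2.1 x k.2.1)
          k.2.2.2.1 M (.dist k.2.2.2.2)) := by
        intro k hk
        obtain ⟨k, hk', rfl⟩ := List.mem_map.1 hk
        obtain ⟨-, n, hx, hn⟩ := hI k hk'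
        exact ⟨hx, TT_deriv M hn⟩
      have e' : Deriv Γ1 w1 N (.dist
          ((I.map fun k : ℚ × Ctx × ℚ × ITy × DTy => (k.1, k.2.2.2.1, k.2.1, k.2.2.1, k.2.2.2.2)).map
            fun k => (k.1, k.2.1))) := by
        simp only [List.map_map] at e ⊢; exact e
      have f := Deriv.letin x (M := M) _ (fun k hk => (key k hk).1)
        (fun i => Classical.choice (key _ (List.get_mem _ i)).2) e'
      simp only [List.map_map] at f ⊢
      exact ⟨f⟩
end

theorem tight_sound {M : Tm} (hM : M.Closed) {w a} (ha : Tight a)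
    (h : Nonempty (Deriv emptyCtx w M (.dist a))) :
    ∃ s, normD a ≤ evalP s M ∧ w ≤ etime s M := by
  obtain ⟨d⟩ := h
  obtain ⟨n, hn⟩ := d.good
  exact ⟨n, sound (fun _ => trivial) n M hM a w n le_rfl ha hn⟩

theorem tight_complete {M : Tm} (hM : M.Closed) (k : ℕ) :
    ∃ a w, Tight a ∧ Nonempty (Deriv emptyCtx w M (.dist a)) ∧ normD a = evalP k M ∧
      etime k M ≤ w := by
  obtain ⟨a, w, n, ha, ht, h1, h2⟩ := complete (ok := ok01)
    (fun q r hq hr => ⟨mul_pos hq.1 hr.1, mul_le_one₀ hq.2 hr.1.le hr.2⟩)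
    (by constructor <;> norm_num) (by constructor <;> norm_num) k M hM
  exact ⟨a, w, ha, TT_deriv M ht, h1, h2⟩

theorem ETime_eq {M : Tm} (hM : M.Closed) :
    ETime M = ⨆ n : ℕ, ENNReal.ofReal ((etime n M : ℚ) : ℝ) := by
  rw [ETime, ENNReal.tsum_eq_iSup_nat]
  congr 1
  funext n
  rw [← ENNReal.ofReal_sum_of_nonneg]
  · congr 1
    simp [etime]
  · intro i _
    have := (evalP_bounds i M hM).2
    rw [sub_nonneg]
    exact_mod_cast this

/-- **Tight Typing, AST, and PAST**: a closed term is AST iff the sup of the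
norms of its tight typings is `1`, and PAST iff the sup of the weights of its
tight derivations is finite. -/
theorem tight_typing_ast_past {M : Tm} (hM : M.Closed) :
    (ProbTerm M = 1 ↔
      sSup {x : ℝ | ∃ (w : ℚ) (a : DTy), Tight a ∧
        Nonempty (Deriv emptyCtx w M (.dist a)) ∧ x = ((normD a : ℚ) : ℝ)} = 1) ∧
    (ETime M < ⊤ ↔
      sSup {x : ℝ≥0∞ | ∃ (w : ℚ) (a : DTy), Tight a ∧
        Nonempty (Deriv emptyCtx w M (.dist a)) ∧
        x = ENNReal.ofReal ((w : ℚ) : ℝ)} < ⊤) := by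


  constructor
  · have : sSup {x : ℝ | ∃ (w : ℚ) (a : DTy), Tight a ∧
        Nonempty (Deriv emptyCtx w M (.dist a)) ∧ x = ((normD a : ℚ) : ℝ)} = ProbTerm M := by
      have hb : BddAbove (Set.range fun k : ℕ => ((evalP k M : ℚ) : ℝ)) := by
        refine ⟨1, ?_⟩
        rintro _ ⟨k, rfl⟩
        have := (evalP_bounds k M hM).2
        show ((evalP k M : ℚ) : ℝ) ≤ 1
        exact_mod_cast this
      have hle : ∀ x ∈ {x : ℝ | ∃ (w : ℚ) (a : DTy), Tight a ∧
          Nonempty (Deriv emptyCtx w M (.dist a)) ∧ x = ((normD a : ℚ) : ℝ)},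
          x ≤ ProbTerm M := by
        rintro x ⟨w, a, ha, h, rfl⟩
        obtain ⟨s, hs, -⟩ := tight_sound hM ha h
        have h1 : ((normD a : ℚ) : ℝ) ≤ ((evalP s M : ℚ) : ℝ) := by exact_mod_cast hs
        exact h1.trans (le_ciSup hb s)
      apply le_antisymm
      · refine csSup_le ?_ hle
        obtain ⟨a, w, ha, h, -, -⟩ := tight_complete hM 0
        exact ⟨_, w, a, ha, h, rfl⟩
      · refine ciSup_le fun k => ?_
        obtain ⟨a, w, ha, h, h1, -⟩ := tight_complete hM k
        refine le_csSup ⟨_, hle⟩ ⟨w, a, ha, h, ?_⟩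
        rw [h1]
    rw [this]
  · have : sSup {x : ℝ≥0∞ | ∃ (w : ℚ) (a : DTy), Tight a ∧
        Nonempty (Deriv emptyCtx w M (.dist a)) ∧
        x = ENNReal.ofReal ((w : ℚ) : ℝ)} = ETime M := by
      rw [ETime_eq hM]
      apply le_antisymm
      · refine sSup_le ?_
        rintro x ⟨w, a, ha, h, rfl⟩
        obtain ⟨s, -, hs⟩ := tight_sound hM ha h
        refine le_trans (ENNReal.ofReal_le_ofReal ?_)
          (le_iSup (fun n : ℕ => ENNReal.ofReal ((etime n M : ℚ) : ℝ)) s)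
        exact_mod_cast hs
      · refine iSup_le fun k => ?_
        obtain ⟨a, w, ha, h, -, h1⟩ := tight_complete hM k
        refine le_trans (ENNReal.ofReal_le_ofReal ?_) (le_sSup ⟨w, a, ha, h, rfl⟩)
        exact_mod_cast h1
    rw [this]

end CbV
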